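/- Let V be a 12-dimensional vector space over an algebraically closed field K of characteristic zero. There exist five 3-dimensional linear subspaces H_1, …, H_5 of V such that the intersection Q_9(H_1) ∩ Q_9(H_2) ∩ Q_9(H_3) ∩ Q_9(H_4) ∩ Q_9(H_5) inside ⋀^9 V has dimension exactly C(12,3) − 5·(3·9 + 1) = 80. -/

import Mathlib

open ExteriorAlgebra

/-- `Q K d H` : the `K`-linear span in `⋀^d V` of all elements `x ∧ y ∧ m` with
`x, y ∈ H` and `m ∈ ⋀^(d-2) V`. -/
def Q (K : Type*) {V : Type*} [Field K] [AddCommGroup V] [Module K V]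
    (d : ℕ) (H : Submodule K V) : Submodule K (ExteriorAlgebra K V) :=
  Submodule.span K
    {z | ∃ x ∈ H, ∃ y ∈ H, ∃ m ∈ ⋀[K]^(d-2) V, z = ι K x * ι K y * m}



/-- index of the `a`-th vector in block `p` -/
def ix (p : Fin 4) (a : Fin 3) : Fin 12 := ⟨3 * p.1 + a.1, by omega⟩

def trip3 : List (Fin 4 × Fin 4 × Fin 4) := [(0,1,2),(0,1,3),(0,2,3),(1,2,3)]
def trip9 : List (Fin 4 × Fin 4 × Fin 4) :=
  [(0,1,2),(0,1,3),(0,2,1),(0,2,3),(0,3,2),(1,2,0),(1,2,3),(1,3,0),(2,3,1)]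
def trip14 : List (Fin 4 × Fin 4 × Fin 4) :=
  [(0, 3, 2), (1, 0, 3), (1, 3, 0), (1, 3, 2), (2, 0, 3), (2, 1, 0), (2, 1, 3), (2, 3, 0),
   (2, 3, 1), (3, 0, 2), (3, 1, 0), (3, 1, 2), (3, 2, 0), (3, 2, 1)]
def lett (a b c : Fin 3) (t : Fin 4 × Fin 4 × Fin 4) : Fin 12 × Fin 12 × Fin 12 :=
  (ix t.1 a, ix t.2.1 b, ix t.2.2 c)
def piv : List (Fin 12 × Fin 12 × Fin 12) :=
  ([0,1,2] : List (Fin 3)).flatMap (fun a => trip3.map (lett a a a)) ++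
  ([(0,1),(0,2),(1,0),(1,2),(2,0),(2,1)] : List (Fin 3 × Fin 3)).flatMap
    (fun ab => trip9.map (lett ab.1 ab.1 ab.2)) ++
  trip14.map (lett 0 1 2)

theorem piv_length : piv.length = 80 := by decide

section
variable {K : Type*} [Field K] [CharZero K]

theorem comb_aab (g : Fin 4 → Fin 4 → Fin 4 → K) (h1 : ∀ p q r, g p q r = - g q p r)
    (h2 : ∀ p q, g p q q = 0) (hs : ∀ r, ∑ p, ∑ q, g r p q = 0)
    (hl : ∀ t ∈ trip9, g t.1 t.2.1 t.2.2 = 0) (p q r) : g p q r = 0 := by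
  have h0 : ∀ p r, g p p r = 0 := fun p r => by have := h1 p p r; grind
  have h3 : ∀ p q, g p q p = 0 := fun p q => by rw [h1, h2, neg_zero]
  simp only [trip9, List.forall_mem_cons, List.not_mem_nil, false_imp_iff, implies_true, and_true] at hl
  obtain ⟨l1, l2, l3, l4, l5, l6, l7, l8, l9⟩ := hl
  have e0 := hs 0
  have e1 := hs 1
  have e2 := hs 2
  simp only [Fin.sum_univ_four, h0, h2, h3] at e0 e1 e2
  rw [h1 1 0, h1 1 0] at e1
  rw [h1 2 0, h1 2 0, h1 2 1, h1 2 1] at e2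
  simp only [l1, l2, l3, l4, l5, l6, l7, l8, l9] at e0 e1 e2
  have hlt : ∀ p q r, p < q → g p q r = 0 := by
    intro p q r hpq
    fin_cases p <;> fin_cases q <;> first | (exfalso; revert hpq; decide) | skip
    all_goals (fin_cases r <;> first | apply h2 | apply h3 | assumption | (simp at *; grind))
  rcases lt_trichotomy p q with h | h | h
  · exact hlt _ _ _ h
  · rw [h, h0]
  · rw [h1, hlt _ _ _ h, neg_zero]

theorem comb_abc (g : Fin 4 → Fin 4 → Fin 4 → K) 
    (h0 : ∀ p q, g p p q = 0) (h2 : ∀ p q, g p q q = 0) (h3 : ∀ p q, g p q p = 0)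
    (s1 : ∀ r, ∑ p, ∑ q, g r p q = 0) (s2 : ∀ r, ∑ p, ∑ q, g p r q = 0)
    (s3 : ∀ r, ∑ p, ∑ q, g p q r = 0)
    (hl : ∀ t ∈ trip14, g t.1 t.2.1 t.2.2 = 0) (p q r) : g p q r = 0 := by
  simp only [trip14, List.forall_mem_cons, List.not_mem_nil, false_imp_iff, implies_true, and_true] at hl
  obtain ⟨l1, l2, l3, l4, l5, l6, l7, l8, l9, l10, l11, l12, l13, l14⟩ := hl
  have e0 := s1 0
  have e1 := s1 1
  have e2 := s1 2
  have e3 := s1 3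
  have f0 := s2 0
  have f1 := s2 1
  have f2 := s2 2
  have f3 := s2 3
  have g0 := s3 0
  have g1 := s3 1
  have g2 := s3 2
  have g3 := s3 3
  simp only [Fin.sum_univ_four, h0, h2, h3, l1, l2, l3, l4, l5, l6, l7, l8, l9, l10, l11, l12, l13, l14,
    zero_add, add_zero] at e0 e1 e2 e3 f0 f1 f2 f3 g0 g1 g2 g3
  fin_cases p <;> fin_cases q <;> first | apply h0 | skip
  all_goals (fin_cases r <;> first | apply h2 | apply h3 | assumption | (simp at *; grind))

theorem comb (u : Fin 12 → Fin 12 → Fin 12 → K) (a1 : ∀ i j k, u i j k = - u j i k)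
    (a2 : ∀ i j k, u i j k = - u i k j)
    (hb : ∀ j p a b, u j (ix p a) (ix p b) = 0)
    (hs : ∀ j a b, ∑ p, ∑ q, u j (ix p a) (ix q b) = 0)
    (hl : ∀ t ∈ piv, u t.1 t.2.1 t.2.2 = 0) (i j k) : u i j k = 0 := by
  have hb2 : ∀ j p a b, u (ix p a) (ix p b) j = 0 := fun j p a b => by
    rw [a2, a1, hb]; simp
  have hb3 : ∀ j p a b, u (ix p a) j (ix p b) = 0 := fun j p a b => by
    rw [a1, hb]; simp
  have hl3 : ∀ a, ∀ t ∈ trip3, u (ix t.1 a) (ix t.2.1 a) (ix t.2.2 a) = 0 := by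
    intro a t ht
    refine hl (lett a a a t) ?_
    fin_cases a <;> simp [piv] <;> grind
  have hl9 : ∀ a b, a ≠ b → ∀ t ∈ trip9, u (ix t.1 a) (ix t.2.1 a) (ix t.2.2 b) = 0 := by
    intro a b hab t ht
    refine hl (lett a a b t) ?_
    fin_cases a <;> fin_cases b <;> simp [piv] at hab ⊢ <;> grind
  have hl14 : ∀ t ∈ trip14, u (ix t.1 0) (ix t.2.1 1) (ix t.2.2 2) = 0 := by
    intro t ht
    refine hl (lett 0 1 2 t) ?_
    simp [piv]; grind
  have A3 : ∀ a p q r, u (ix p a) (ix q a) (ix r a) = 0 := by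
    intro a
    have hh := hl3 a
    simp only [trip3, List.forall_mem_cons, List.not_mem_nil, false_imp_iff, implies_true, and_true] at hh
    obtain ⟨l1, l2, l3, l4⟩ := hh
    have hlt : ∀ p q r, p < q → q < r → u (ix p a) (ix q a) (ix r a) = 0 := by
      intro p q r h h'
      fin_cases p <;> fin_cases q <;> first | (exfalso; revert h; decide) | skip
      all_goals (fin_cases r <;> first | (exfalso; revert h'; decide) | assumption)
    intro p q r
    rcases lt_trichotomy p q with h | h | h <;> rcases lt_trichotomy q r with h' | h' | h' <;>
      rcases lt_trichotomy p r with h'' | h'' | h'' <;> grind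
  have A9 : ∀ a b, a ≠ b → ∀ p q r, u (ix p a) (ix q a) (ix r b) = 0 := by
    intro a b hab
    exact comb_aab (fun p q r => u (ix p a) (ix q a) (ix r b)) (fun _ _ _ => a1 _ _ _)
      (fun _ _ => hb _ _ _ _) (fun r => hs _ _ _) (hl9 a b hab)
  have A14 : ∀ p q r, u (ix p 0) (ix q 1) (ix r 2) = 0 := by
    refine comb_abc (fun p q r => u (ix p 0) (ix q 1) (ix r 2)) (fun _ _ => hb2 _ _ _ _)
      (fun _ _ => hb _ _ _ _) (fun _ _ => hb3 _ _ _ _) (fun r => hs _ _ _) (fun r => ?_) (fun r => ?_) hl14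
    · have := hs (ix r 1) 0 2
      simp only [a1 (ix r 1), Finset.sum_neg_distrib, neg_eq_zero] at this
      exact this
    · have := hs (ix r 2) 0 1
      simp only [a1 (ix r 2), a2 _ (ix r 2), Finset.sum_neg_distrib, neg_eq_zero] at this
      exact this
  have surj : ∀ i, ∃ p a, i = ix p a := by decide
  obtain ⟨p, a, rfl⟩ := surj i
  obtain ⟨q, b, rfl⟩ := surj j
  obtain ⟨r, c, rfl⟩ := surj k
  by_cases hab : a = b
  · subst hab
    by_cases hac : a = c
    · subst hac; apply A3
    · exact A9 _ _ hac _ _ _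
  by_cases hac : a = c
  · subst hac
    rw [a2, A9 _ _ hab, neg_zero]
  by_cases hbc : b = c
  · subst hbc
    rw [a1, a2, A9 _ _ (Ne.symm hab)]; simp
  fin_cases a <;> fin_cases b <;> first | exact absurd rfl hab | skip
  all_goals (fin_cases c <;> first | exact absurd rfl hac | exact absurd rfl hbc | skip)
  all_goals simp only [Fin.zero_eta, Fin.mk_one, Fin.reduceFinMk] 
  · apply A14
  · rw [a2, A14, neg_zero]
  · rw [a1, A14, neg_zero]
  · rw [a2, a1, A14]; simp
  · rw [a1, a2, A14]; simp
  · rw [a1, a2, a1, A14]; simp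
end

section
open Module Set Set.powersetCard
variable {K V : Type*} [Field K] [AddCommGroup V] [Module K V]

theorem nondeg (b : Basis (Fin 12) K V) (z : ExteriorAlgebra K V) (hz : z ∈ ⋀[K]^9 V)
    (h : ∀ i j k, b.ExteriorAlgebra.coord Finset.univ
      (ι K (b i) * ι K (b j) * ι K (b k) * z) = 0) : z = 0 := by
  have hT : ∀ T : powersetCard (Fin 12) 3,
      b.ExteriorAlgebra.coord Finset.univ (b.ExteriorAlgebra T * z) = 0 := by
    intro T
    have := h (ofFinEmbEquiv.symm T 0) (ofFinEmbEquiv.symm T 1) (ofFinEmbEquiv.symm T 2)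
    rw [ExteriorAlgebra.basis_apply_powersetCard, ExteriorAlgebra.ιMulti_family, ιMulti_apply]
    simpa [List.ofFn_succ, mul_assoc] using this
  have hsum := (b.exteriorPower 9).sum_repr ⟨z, hz⟩
  have hsum' := congrArg (Submodule.subtype _) hsum
  simp only [map_sum, map_smul, Submodule.subtype_apply, ← ExteriorAlgebra.basis_eq_coe_basis] at hsum'
  have hc : ∀ S, (b.exteriorPower 9).repr ⟨z, hz⟩ S = 0 := by
    intro S
    have hcard : (S.val)ᶜ.card = 3 := by
      rw [Finset.card_compl, card_eq S]; rfl
    let T : powersetCard (Fin 12) 3 := ⟨S.valᶜ, hcard⟩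
    have h1 := hT T
    rw [← hsum', Finset.mul_sum, map_sum, Finset.sum_eq_single S] at h1
    · have hd : Disjoint T.val S.val := disjoint_compl_left
      have hu : ((disjUnion hd : powersetCard (Fin 12) (3+9)) : Finset (Fin 12)) = Finset.univ := by
        rw [coe_disjUnion, Finset.disjUnion_eq_union]
        ext x; simp [T]; tauto
      rw [mul_smul_comm, ExteriorAlgebra.basis_mul_of_disjoint b T S hd, hu] at h1
      rcases Int.units_eq_one_or (permOfDisjoint hd).sign with hh | hh <;> rw [hh] at h1 <;>
        simpa [Units.smul_def] using h1
    · intro S' _ hne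
      have hd : ¬ Disjoint T.val S'.val := by
        intro hd
        apply hne
        have hsub : S'.val ⊆ S.val := by
          intro x hx
          by_contra hxS
          exact Finset.disjoint_left.mp hd (by simpa [T] using hxS) hx
        exact Subtype.ext (Finset.eq_of_subset_of_card_le hsub (by rw [card_eq S, card_eq S']))
      rw [mul_smul_comm, ExteriorAlgebra.basis_mul_of_not_disjoint b T S' hd]
      simp
    · simp
  rw [← hsum']
  simp [hc]

/-- the 28 bad subsets -/
def badS : Finset (Finset (Fin 12)) :=
  (Finset.univ.powersetCard 9).filter (fun S => (S ∩ {0,1,2}).card ≤ 1)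

theorem badS_card : badS.card = 28 := by decide +kernel

theorem adapted [FiniteDimensional K V] (hV : finrank K V = 12) (H : Submodule K V)
    (hH : finrank K H = 3) : ∃ c : Basis (Fin 12) K V, ∀ i : Fin 12, i.1 < 3 → c i ∈ H := by
  obtain ⟨W, hW⟩ := H.exists_isCompl
  have hW9 : finrank K W = 9 := by
    have := Submodule.finrank_add_eq_of_isCompl hW
    omega
  let c := (((finBasisOfFinrankEq K H hH).prod (finBasisOfFinrankEq K W hW9)).map
    (Submodule.prodEquivOfIsCompl H W hW)).reindex finSumFinEquiv
  refine ⟨c, fun i hi => ?_⟩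
  have : i = finSumFinEquiv (m := 3) (n := 9) (Sum.inl ⟨i.1, hi⟩) := by
    rfl
  rw [this]
  simp [c]

theorem lower [FiniteDimensional K V] (hV : finrank K V = 12) (H : Submodule K V)
    (hH : finrank K H = 3) : ∃ L : ⋀[K]^9 V →ₗ[K] (badS → K), ∀ z, L z = 0 → (z : ExteriorAlgebra K V) ∈ Q K 9 H := by
  obtain ⟨c, hc⟩ := adapted hV H hH
  refine ⟨LinearMap.pi fun S => (c.exteriorPower 9).coord
    ⟨S.1, by have := S.2; simp only [badS, Finset.mem_filter, Finset.mem_powersetCard] at this; exact this.1.2⟩, ?_⟩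
  intro z hz
  have hsum := (c.exteriorPower 9).sum_repr z
  rw [← hsum, Submodule.coe_sum]
  refine Submodule.sum_mem _ fun S _ => ?_
  by_cases hS : S.val ∈ badS
  · have := congrFun hz ⟨S.val, hS⟩
    have h0 : (c.exteriorPower 9).repr z S = 0 := this
    rw [h0]; simp
  · rw [Submodule.coe_smul]
    refine Submodule.smul_mem _ _ ?_
    have hS2 : 1 < (S.val ∩ {0,1,2}).card := by
      by_contra hcon
      apply hS
      simp only [badS, Finset.mem_filter, Finset.mem_powersetCard]
      exact ⟨⟨Finset.subset_univ _, S.2⟩, by omega⟩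
    set f := ofFinEmbEquiv.symm S with hf
    have hf1 : (f 1).1 < 3 := by
      by_contra hcon
      have : S.val ∩ {0,1,2} ⊆ {f 0} := by
        intro x hx
        rw [Finset.mem_inter] at hx
        obtain ⟨k, rfl⟩ := (mem_range_ofFinEmbEquiv_symm_iff_mem S x).mpr hx.1
        by_cases hk : k = 0
        · simp [hk, hf]
        · have : f 1 ≤ f k := f.monotone (by
            rw [Fin.le_def]; have : k.1 ≠ 0 := fun h => hk (Fin.ext h)
            simp; omega)
          have h3 : (f k).1 < 3 := by
            have := hx.2
            rw [← hf] at this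
            simp only [Finset.mem_insert, Finset.mem_singleton] at this
            rcases this with h | h | h <;> rw [h] <;> decide
          rw [Fin.le_def] at this
          omega
      have := Finset.card_le_card this
      simp at this
      omega
    have hf0 : (f 0).1 < 3 := by
      have : f 0 ≤ f 1 := f.monotone (by decide)
      rw [Fin.le_def] at this
      omega
    refine Submodule.subset_span ⟨c (f 0), hc _ hf0, c (f 1), hc _ hf1,
      ιMulti K 7 (fun i => c (f i.succ.succ)), ?_, ?_⟩
    · exact (exteriorPower.ιMulti K 7 (fun i => c (f i.succ.succ))).2
    · rw [exteriorPower.basis_apply, exteriorPower.ιMulti_family_apply_coe, ExteriorAlgebra.ιMulti_family,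
        ιMulti_succ_apply, ιMulti_succ_apply, mul_assoc]
      rfl

theorem annih (H : Submodule K V) [FiniteDimensional K H] (hH : finrank K H = 3) {u v : V} (hu : u ∈ H) (hv : v ∈ H)
    {z : ExteriorAlgebra K V} (hz : z ∈ Q K 9 H) : ι K u * ι K v * z = 0 := by
  induction hz using Submodule.span_induction with
  | zero => simp
  | add x y _ _ hx hy => rw [mul_add, hx, hy, add_zero]
  | smul a x _ hx => rw [mul_smul_comm, hx, smul_zero]
  | mem w hw =>
    obtain ⟨x, hx, y, hy, m, hm, rfl⟩ := hw
    have h4 : ιMulti K 4 ![u, v, x, y] = 0 := by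
      apply AlternatingMap.map_linearDependent
      intro hli
      let g : Fin 4 → H := ![⟨u, hu⟩, ⟨v, hv⟩, ⟨x, hx⟩, ⟨y, hy⟩]
      have hg : LinearIndependent K g := by
        apply LinearIndependent.of_comp H.subtype
        have hgc : (H.subtype ∘ g) = ![u, v, x, y] := by
          ext i; fin_cases i <;> rfl
        rw [hgc]; exact hli
      have := hg.fintype_card_le_finrank
      simp [hH] at this
    rw [ιMulti_apply] at h4
    simp [List.ofFn_succ] at h4
    calc _ = (ι K u * (ι K v * (ι K x * ι K y))) * m := by simp only [mul_assoc]
      _ = 0 := by rw [h4, zero_mul]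
end

section
open Module
variable {K V : Type*} [Field K] [AddCommGroup V] [Module K V]

/-- the five triples of vectors -/
noncomputable def vec (b : Basis (Fin 12) K V) (i : Fin 5) (a : Fin 3) : V :=
  if h : i.1 < 4 then b (ix ⟨i.1, h⟩ a) else ∑ p, b (ix p a)

theorem ix_inj (p q : Fin 4) (a c : Fin 3) : ix p a = ix q c ↔ p = q ∧ a = c := by
  revert p q a c; decide

theorem vec_li (b : Basis (Fin 12) K V) (i : Fin 5) : LinearIndependent K (vec b i) := by
  rw [Fintype.linearIndependent_iff]
  intro g hg a
  by_cases h : i.1 < 4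
  · simp only [vec, h, dif_pos] at hg
    have := congrArg (fun v => b.repr v (ix ⟨i.1, h⟩ a)) hg
    simpa [Finsupp.single_apply, ix_inj] using this
  · simp only [vec, h, dif_neg, not_false_eq_true] at hg
    have := congrArg (fun v => b.repr v (ix 0 a)) hg
    simpa [Finsupp.single_apply, ix_inj, ite_and, Finset.sum_ite_irrel] using this

noncomputable def HH (b : Basis (Fin 12) K V) (i : Fin 5) : Submodule K V :=
  Submodule.span K (Set.range (vec b i))

theorem HH_finrank (b : Basis (Fin 12) K V) (i : Fin 5) : finrank K (HH b i) = 3 := by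
  rw [HH, finrank_span_eq_card (vec_li b i)]; rfl

theorem Q_le (H : Submodule K V) : Q K 9 H ≤ ⋀[K]^9 V := by
  rw [Q, Submodule.span_le]
  rintro z ⟨x, hx, y, hy, m, hm, rfl⟩
  have h1 : ∀ x : V, ι K x ∈ ⋀[K]^1 V := fun x => by
    rw [exteriorPower, pow_one]; exact LinearMap.mem_range_self _ _
  exact SetLike.mul_mem_graded (A := fun i : ℕ => ⋀[K]^i V)
    (SetLike.mul_mem_graded (A := fun i : ℕ => ⋀[K]^i V) (h1 x) (h1 y)) hm

theorem final_ge [FiniteDimensional K V] (hV : finrank K V = 12) (H : Fin 5 → Submodule K V)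
    (hH : ∀ i, finrank K (H i) = 3) : 80 ≤ finrank K ↥(⨅ i, Q K 9 (H i)) := by
  choose L hL using fun i => lower hV (H i) (hH i)
  let M : ⋀[K]^9 V →ₗ[K] (Fin 5 → badS → K) := LinearMap.pi L
  have h1 := M.finrank_range_add_finrank_ker
  have h2 : finrank K (LinearMap.range M) ≤ 140 := by
    refine (Submodule.finrank_le _).trans ?_
    rw [finrank_pi_fintype]
    simp [badS_card]
  rw [exteriorPower.finrank_eq, hV] at h1
  have h220 : Nat.choose 12 9 = 220 := by decide
  have h3 : (LinearMap.ker M).map (Submodule.subtype _) ≤ ⨅ i, Q K 9 (H i) := by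
    rintro _ ⟨z, hz, rfl⟩
    rw [Submodule.mem_iInf]
    intro i
    exact hL i z (congrFun (LinearMap.mem_ker.mp hz) i)
  have hle : (⨅ i, Q K 9 (H i)) ≤ ⋀[K]^9 V := (iInf_le _ 0).trans (Q_le _)
  have : FiniteDimensional K ↥(⨅ i, Q K 9 (H i)) := Submodule.finiteDimensional_of_le hle
  have h4 := Submodule.finrank_mono h3
  rw [Submodule.finrank_map_subtype_eq] at h4
  omega

theorem final_le [CharZero K] [FiniteDimensional K V] (b : Basis (Fin 12) K V) :
    finrank K ↥(⨅ i, Q K 9 (HH b i)) ≤ 80 := by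
  let φ := b.ExteriorAlgebra.coord Finset.univ
  let M : ↥(⨅ i, Q K 9 (HH b i)) →ₗ[K] (Fin piv.length → K) :=
    LinearMap.pi fun n => φ ∘ₗ LinearMap.mulLeft K
      (ι K (b (piv.get n).1) * ι K (b (piv.get n).2.1) * ι K (b (piv.get n).2.2)) ∘ₗ
      Submodule.subtype _
  have hM : Function.Injective M := by
    rw [← LinearMap.ker_eq_bot, LinearMap.ker_eq_bot']
    rintro ⟨z, hz⟩ h0
    rw [Submodule.mem_iInf] at hz
    have hsw : ∀ x y : V, ι K x * ι K y = - (ι K y * ι K x) := fun x y =>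
      eq_neg_of_add_eq_zero_left (ι_add_mul_swap x y)
    have hv : ∀ (j : Fin 12) (i : Fin 5) (a c : Fin 3),
        φ (ι K (b j) * ι K (vec b i a) * ι K (vec b i c) * z) = 0 := by
      intro j i a c
      have := annih (HH b i) (HH_finrank b i) (Submodule.subset_span ⟨a, rfl⟩)
        (Submodule.subset_span ⟨c, rfl⟩) (hz i)
      rw [mul_assoc (ι K (b j)), mul_assoc (ι K (b j)), this, mul_zero, map_zero]
    have hz0 : z = 0 := by
      refine nondeg b z (Q_le _ (hz 0)) (fun i j k => ?_)
      refine comb (fun i j k => φ (ι K (b i) * ι K (b j) * ι K (b k) * z)) ?_ ?_ ?_ ?_ ?_ i j k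
      · intro i j k
        rw [hsw (b i) (b j)]; simp
      · intro i j k
        rw [mul_assoc (ι K (b i)), hsw (b j) (b k)]; simp [mul_assoc]
      · intro j p a c
        have := hv j ⟨p.1, by omega⟩ a c
        simpa [vec] using this
      · intro j a c
        have := hv j 4 a c
        simp only [vec, show ¬ ((4 : Fin 5).1 < 4) by decide, dif_neg, not_false_eq_true] at this
        simp only [map_sum, Finset.mul_sum, Finset.sum_mul] at this
        rw [Finset.sum_comm]
        exact this
      · intro t ht
        obtain ⟨n, rfl⟩ := List.mem_iff_get.mp ht
        exact congrFun h0 n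
    exact Subtype.ext hz0
  have := LinearMap.finrank_le_finrank_of_injective hM
  rw [finrank_pi, Fintype.card_fin, piv_length] at this
  exact this
end

/-- For a 12-dimensional space `V` there exist five 3-dimensional subspaces
`H₁, …, H₅` with `dim (Q₉(H₁) ∩ ⋯ ∩ Q₉(H₅)) = C(12,3) - 5·(3·9 + 1) = 80`
inside `⋀^9 V`. -/
theorem stmt17 {K V : Type*} [Field K] [CharZero K] [IsAlgClosed K]
    [AddCommGroup V] [Module K V] [FiniteDimensional K V]
    (hV : Module.finrank K V = 12) :
    ∃ H : Fin 5 → Submodule K V,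
      (∀ i, Module.finrank K (H i) = 3) ∧
      Module.finrank K ↥(⨅ i, Q K 9 (H i)) = Nat.choose 12 3 - 5 * (3 * 9 + 1) ∧
      Module.finrank K ↥(⨅ i, Q K 9 (H i)) = 80 := by
  let b := Module.finBasisOfFinrankEq K V hV
  have h : Module.finrank K ↥(⨅ i, Q K 9 (HH b i)) = 80 :=
    le_antisymm (final_le b) (final_ge hV _ (HH_finrank b))
  exact ⟨HH b, HH_finrank b, h, h⟩
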